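/- There exist a constant C > 0 and a threshold L₀ ≥ R₀, depending only on v and R₀, with the following property. Suppose L ≥ L₀, 0 ≤ E ≤ 3 μ 𝔞₀^μ/(L − R₀)³, and f_L is the Neumann scattering function of a Neumann scattering solution with energy E, regarded as the radial function f_L(|x|) on the ball {|x| ≤ L} of ℝ³. Then |∫_{|x|≤L} v(|x|) f_L(|x|) dx − 4π μ 𝔞₀^μ| ≤ C 𝔞₀^μ / L and |∫_{|x|≤L} v(|x|) f_L(|x|)² dx − ∫_{ℝ³} v(|x|) f(|x|)² dx| ≤ C μ 𝔞₀^μ / L, where f is the scattering function of a zero-energy scattering solution. -/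

import Mathlib

open Set MeasureTheory

/-- A zero-energy scattering solution `m` for the radial potential `v` supported in `[0, R₀]`
with semiclassical parameter `μ`: it satisfies `μ m'' = v m` on `(0,∞)`, is continuous on
`[0,∞)` and continuously differentiable on `(0,∞)`, with `m(0) = 0`, `m > 0` on `(0,∞)`, and
`m(r) = r - 𝔞₀^μ` for `r ≥ R₀`, where `𝔞₀^μ := R₀ - m(R₀)` is the scattering length. -/
structure ZeroEnergyScattering (v : ℝ → ℝ) (R₀ μ : ℝ) (m : ℝ → ℝ) : Prop where
  cont : ContinuousOn m (Set.Ici 0)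
  diff : ∀ r ∈ Set.Ioi (0 : ℝ), DifferentiableAt ℝ m r
  derivCont : ContinuousOn (deriv m) (Set.Ioi 0)
  diff2 : ∀ r ∈ Set.Ioi (0 : ℝ), DifferentiableAt ℝ (deriv m) r
  ode : ∀ r ∈ Set.Ioi (0 : ℝ), μ * deriv (deriv m) r = v r * m r
  zero : m 0 = 0
  pos : ∀ r ∈ Set.Ioi (0 : ℝ), 0 < m r
  radiation : ∀ r, R₀ ≤ r → m r = r - (R₀ - m R₀)

/-- A Neumann scattering solution `m₁` with energy `E` on `[0, L]`: it satisfies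
`μ m₁'' = (v - E) m₁` on `(0,L)`, is continuous on `[0,L]` and continuously differentiable
on `(0,L]`, with `m₁(0) = 0`, `m₁ > 0` on `(0,L]`, `m₁(L) = L` and `m₁'(L) = 1`.  The Neumann
scattering function is `f_L(r) = m₁(r)/r`. -/
structure NeumannScattering (v : ℝ → ℝ) (μ L E : ℝ) (m₁ : ℝ → ℝ) : Prop where
  cont : ContinuousOn m₁ (Set.Icc 0 L)
  diff : ∀ r ∈ Set.Ioc (0 : ℝ) L, DifferentiableAt ℝ m₁ r
  derivCont : ContinuousOn (deriv m₁) (Set.Ioc 0 L)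
  diff2 : ∀ r ∈ Set.Ioo (0 : ℝ) L, DifferentiableAt ℝ (deriv m₁) r
  ode : ∀ r ∈ Set.Ioo (0 : ℝ) L, μ * deriv (deriv m₁) r = (v r - E) * m₁ r
  zero : m₁ 0 = 0
  pos : ∀ r ∈ Set.Ioc (0 : ℝ) L, 0 < m₁ r
  bc : m₁ L = L
  bc' : deriv m₁ L = 1

/-- Integration in polar coordinates on `ℝ³` of a radial function supported in a ball. -/
lemma integral_radial_fin_three {h : ℝ → ℝ} {L : ℝ} (hL : 0 ≤ L) (hh : ∀ r, L ≤ r → h r = 0) :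
    ∫ x : EuclideanSpace ℝ (Fin 3), h ‖x‖ = 4 * Real.pi * ∫ r in (0 : ℝ)..L, r ^ 2 * h r := by
  have hball : (volume : Measure (EuclideanSpace ℝ (Fin 3))).real (Metric.ball 0 1)
      = Real.pi * 4 / 3 := by
    rw [Measure.real, EuclideanSpace.volume_ball_fin_three]
    simp only [ENNReal.ofReal_one, one_pow, one_mul]
    exact ENNReal.toReal_ofReal (by positivity)
  rw [integral_fun_norm_addHaar volume h, hball, intervalIntegral.integral_of_le hL,
    setIntegral_eq_of_subset_of_forall_sdiff_eq_zero measurableSet_Ioi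
      (s := Ioc 0 L) (fun r hr => hr.1)]
  · simp only [finrank_euclideanSpace, Fintype.card_fin, smul_eq_mul, nsmul_eq_mul]
    push_cast
    ring
  · intro r hr
    have hr' : L < r := by
      by_contra hle
      exact hr.2 ⟨hr.1, not_lt.mp hle⟩
    simp [hh r hr'.le]

/-- If `u''` is bounded on `(0, L)` and `w` is continuous with `w 0 = 0`, then `w u'` is
continuous up to the origin. -/
lemma continuousOn_mul_deriv_of_bounded {u w : ℝ → ℝ} {L C : ℝ}
    (hu' : ContinuousOn (deriv u) (Ioc 0 L))
    (hu'' : ∀ r ∈ Ioo 0 L, DifferentiableAt ℝ (deriv u) r)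
    (hC : ∀ r ∈ Ioo 0 L, |deriv (deriv u) r| ≤ C)
    (hw : ContinuousOn w (Icc 0 L)) (hw0 : w 0 = 0) :
    ContinuousOn (fun r => w r * deriv u r) (Icc 0 L) := by
  have hbound : ∀ r ∈ Ioc 0 L, |deriv u r| ≤ |deriv u L| + |C| * L := by
    rintro r ⟨hr0, hrL⟩
    rcases hrL.eq_or_lt with rfl | hlt
    · have : 0 ≤ |C| * r := by positivity
      linarith
    obtain ⟨c, hc, hcs⟩ := exists_deriv_eq_slope (deriv u) hlt
      (hu'.mono fun x hx => ⟨hr0.trans_le hx.1, hx.2⟩)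
      (fun x hx => (hu'' x ⟨hr0.trans hx.1, hx.2⟩).differentiableWithinAt)
    have hcC := hC c ⟨hr0.trans hc.1, hc.2⟩
    rw [eq_div_iff (sub_pos.2 hlt).ne'] at hcs
    have h1 : |deriv u L - deriv u r| ≤ |C| * L := by
      rw [← hcs, abs_mul, abs_of_pos (sub_pos.2 hlt)]
      exact mul_le_mul (hcC.trans (le_abs_self C)) (by linarith) (by linarith) (abs_nonneg _)
    have h2 := abs_sub_abs_le_abs_sub (deriv u r) (deriv u L)
    rw [abs_sub_comm] at h2
    linarith
  intro r hr
  rcases hr.1.eq_or_lt with rfl | hr0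
  · have hlim : Filter.Tendsto (fun r => |w r| * (|deriv u L| + |C| * L))
        (nhdsWithin 0 (Icc 0 L)) (nhds 0) := by
      have := (hw 0 hr).tendsto.abs.mul_const (|deriv u L| + |C| * L)
      simpa only [hw0, abs_zero, zero_mul] using this
    have : Filter.Tendsto (fun r => w r * deriv u r) (nhdsWithin 0 (Icc 0 L)) (nhds 0) := by
      refine squeeze_zero_norm' ?_ hlim
      filter_upwards [self_mem_nhdsWithin] with x hx
      rcases hx.1.eq_or_lt with rfl | hx0
      · simp [hw0]
      · rw [norm_mul]
        exact mul_le_mul_of_nonneg_left (hbound x ⟨hx0, hx.2⟩) (abs_nonneg _)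
    simpa [ContinuousWithinAt, hw0] using this
  · have hnhds : Ioc 0 L ∈ nhdsWithin r (Icc 0 L) := by
      filter_upwards [self_mem_nhdsWithin, mem_nhdsWithin_of_mem_nhds (Ioi_mem_nhds hr0)]
        with x hx hx0
      exact ⟨hx0, hx.2⟩
    exact (hw r hr).mul ((hu' r ⟨hr0, hr.2⟩).mono_of_mem_nhdsWithin hnhds)

/-- If `μ u'' = q u` on `(0, L)` with `q` bounded, then `u''` is bounded there. -/
lemma exists_bound_deriv_deriv {u q : ℝ → ℝ} {μ L Q : ℝ} (hμ : 0 < μ)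
    (hu : ContinuousOn u (Icc 0 L))
    (hode : ∀ r ∈ Ioo 0 L, μ * deriv (deriv u) r = q r * u r)
    (hq : ∀ r, |q r| ≤ Q) :
    ∃ C, ∀ r ∈ Ioo 0 L, |deriv (deriv u) r| ≤ C := by
  obtain ⟨S, hS⟩ := isCompact_Icc.exists_bound_of_continuousOn hu
  refine ⟨Q * S / μ, fun r hr => ?_⟩
  rw [le_div_iff₀ hμ]
  have h := congrArg abs (hode r hr)
  rw [abs_mul, abs_mul, abs_of_pos hμ] at h
  have := mul_le_mul (hq r) (hS r (Ioo_subset_Icc_self hr)) (norm_nonneg _)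
    ((abs_nonneg _).trans (hq r))
  rw [Real.norm_eq_abs] at this
  linarith

lemma intervalIntegrable_mul_of_bounded {v g : ℝ → ℝ} {B L : ℝ} (hL : 0 ≤ L)
    (hv : Measurable v) (hB : ∀ r, |v r| ≤ B) (hg : ContinuousOn g (Icc 0 L)) :
    IntervalIntegrable (fun r => v r * g r) volume 0 L := by
  have hvi : IntervalIntegrable v volume 0 L :=
    (intervalIntegrable_const (c := B)).mono_fun hv.aestronglyMeasurable
      (Filter.Eventually.of_forall fun r => by
        simpa using (hB r).trans (le_abs_self B))
  exact hvi.mul_continuousOn (by rwa [uIcc_of_le hL])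

namespace ZeroEnergyScattering

variable {v m : ℝ → ℝ} {R₀ μ : ℝ}

lemma deriv_eq_one (h : ZeroEnergyScattering v R₀ μ m) {r : ℝ} (hr : R₀ < r) :
    deriv m r = 1 := by
  have : m =ᶠ[nhds r] fun x => x - (R₀ - m R₀) := by
    filter_upwards [Ioi_mem_nhds hr] with x hx using h.radiation x (le_of_lt hx)
  rw [this.deriv_eq]
  simp

lemma monotoneOn_deriv (h : ZeroEnergyScattering v R₀ μ m) (hμ : 0 < μ) (hv : ∀ r, 0 ≤ v r) :
    MonotoneOn (deriv m) (Ioi 0) := by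
  refine monotoneOn_of_deriv_nonneg (convex_Ioi 0) h.derivCont
    (fun r hr => (h.diff2 r (interior_subset hr)).differentiableWithinAt) fun r hr => ?_
  have hr' : r ∈ Ioi (0 : ℝ) := interior_subset hr
  have h1 : 0 ≤ μ * deriv (deriv m) r := by
    rw [h.ode r hr']
    exact mul_nonneg (hv r) (h.pos r hr').le
  exact nonneg_of_mul_nonneg_right h1 hμ

lemma deriv_le_one (h : ZeroEnergyScattering v R₀ μ m) (hμ : 0 < μ) (hv : ∀ r, 0 ≤ v r)
    {r : ℝ} (hr : 0 < r) : deriv m r ≤ 1 := by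
  have hlt : R₀ < max r R₀ + 1 := by linarith [le_max_right r R₀]
  rw [← h.deriv_eq_one hlt]
  have hle : r ≤ max r R₀ + 1 := by linarith [le_max_left r R₀]
  exact h.monotoneOn_deriv hμ hv hr (hr.trans_le hle) hle

lemma monotoneOn_sub (h : ZeroEnergyScattering v R₀ μ m) (hμ : 0 < μ) (hv : ∀ r, 0 ≤ v r) :
    MonotoneOn (fun r => r - m r) (Ici 0) := by
  refine monotoneOn_of_deriv_nonneg (convex_Ici 0) (continuousOn_id.sub h.cont) ?_ ?_
  · rw [interior_Ici]
    exact fun r hr => (differentiableAt_id.sub (h.diff r hr)).differentiableWithinAt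
  · rw [interior_Ici]
    intro r hr
    have : deriv (fun r => r - m r) r = 1 - deriv m r :=
      ((hasDerivAt_id r).sub (h.diff r hr).hasDerivAt).deriv
    rw [this]
    linarith [h.deriv_le_one hμ hv hr]

lemma le_self (h : ZeroEnergyScattering v R₀ μ m) (hμ : 0 < μ) (hv : ∀ r, 0 ≤ v r)
    {r : ℝ} (hr : 0 ≤ r) : m r ≤ r := by
  have := h.monotoneOn_sub hμ hv self_mem_Ici hr hr
  simp only [h.zero] at this
  linarith

lemma sub_le (h : ZeroEnergyScattering v R₀ μ m) (hμ : 0 < μ) (hv : ∀ r, 0 ≤ v r)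
    {r : ℝ} (hr : 0 ≤ r) : r - m r ≤ R₀ - m R₀ := by
  have hle := le_max_left r R₀
  have := h.monotoneOn_sub hμ hv hr (hr.trans hle) hle
  have hrad := h.radiation (max r R₀) (le_max_right _ _)
  simp only at this
  linarith

lemma nonneg (h : ZeroEnergyScattering v R₀ μ m) {r : ℝ} (hr : 0 ≤ r) : 0 ≤ m r := by
  rcases hr.eq_or_lt with rfl | hr
  · exact h.zero.ge
  · exact (h.pos r hr).le

lemma continuousOn_mul_deriv (h : ZeroEnergyScattering v R₀ μ m) (hμ : 0 < μ) {B L : ℝ}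
    (hB : ∀ r, |v r| ≤ B) {w : ℝ → ℝ} (hw : ContinuousOn w (Icc 0 L)) (hw0 : w 0 = 0) :
    ContinuousOn (fun r => w r * deriv m r) (Icc 0 L) := by
  obtain ⟨C, hC⟩ := exists_bound_deriv_deriv (L := L) hμ (h.cont.mono fun r hr => hr.1)
    (fun r hr => h.ode r hr.1) hB
  exact continuousOn_mul_deriv_of_bounded (h.derivCont.mono fun r hr => hr.1)
    (fun r hr => h.diff2 r hr.1) hC hw hw0

/-- The flux identity `∫ v m r dr = μ 𝔞₀^μ`. -/
lemma integral_eq (h : ZeroEnergyScattering v R₀ μ m) (hμ : 0 < μ) (hvm : Measurable v) {B L : ℝ}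
    (hB : ∀ r, |v r| ≤ B) (hR₀ : 0 < R₀) (hL : R₀ < L) :
    ∫ r in (0 : ℝ)..L, v r * (r * m r) = μ * (R₀ - m R₀) := by
  have hL0 : 0 ≤ L := (hR₀.trans hL).le
  have hm : ContinuousOn m (Icc 0 L) := h.cont.mono fun r hr => hr.1
  rw [intervalIntegral.integral_eq_sub_of_hasDerivAt_of_le
    (f := fun r => μ * (r * deriv m r - m r)) hL0
    (continuousOn_const.mul ((h.continuousOn_mul_deriv hμ hB continuousOn_id rfl).sub hm))]
  · rw [h.deriv_eq_one hL, h.radiation L hL.le, h.zero]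
    ring
  · intro r hr
    have hd := ((((hasDerivAt_id r).mul (h.diff2 r hr.1).hasDerivAt).sub
      (h.diff r hr.1).hasDerivAt).const_mul μ)
    refine hd.congr_deriv ?_
    simp only [id]
    linear_combination r * h.ode r hr.1
  · exact intervalIntegrable_mul_of_bounded hL0 hvm hB (continuousOn_id.mul hm)

end ZeroEnergyScattering

namespace NeumannScattering

variable {v m m₁ : ℝ → ℝ} {R₀ μ L E B : ℝ}

lemma nonneg (h : NeumannScattering v μ L E m₁) {r : ℝ} (hr : r ∈ Icc 0 L) : 0 ≤ m₁ r := by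
  rcases hr.1.eq_or_lt with rfl | hr0
  · exact h.zero.ge
  · exact (h.pos r ⟨hr0, hr.2⟩).le

lemma continuousOn_mul_deriv (h : NeumannScattering v μ L E m₁) (hμ : 0 < μ)
    (hB : ∀ r, |v r| ≤ B) {w : ℝ → ℝ} (hw : ContinuousOn w (Icc 0 L)) (hw0 : w 0 = 0) :
    ContinuousOn (fun r => w r * deriv m₁ r) (Icc 0 L) := by
  obtain ⟨C, hC⟩ := exists_bound_deriv_deriv (Q := B + |E|) hμ h.cont h.ode
    (fun r => (abs_sub _ _).trans (add_le_add_left (hB r) _))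
  exact continuousOn_mul_deriv_of_bounded h.derivCont h.diff2 hC hw hw0

/-- At small energy the Neumann scattering function is at most `2`. -/
lemma le_two_mul (h : NeumannScattering v μ L E m₁) (hμ : 0 < μ) (hv : ∀ r, 0 ≤ v r)
    (hL : 0 < L) (hE0 : 0 ≤ E) (hE : E * L ^ 2 ≤ μ / 2) {r : ℝ} (hr : r ∈ Icc 0 L) :
    m₁ r ≤ 2 * r := by
  obtain ⟨s, hs, hmax⟩ := isCompact_Icc.exists_isMaxOn ⟨0, left_mem_Icc.2 hL.le⟩ h.cont
  set S := m₁ s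
  have hS0 : 0 ≤ S := h.nonneg hs
  have hE' : E / μ * L ^ 2 ≤ 1 / 2 := by
    rw [div_mul_eq_mul_div, div_le_iff₀ hμ]
    linarith
  have hmono : MonotoneOn (fun r => deriv m₁ r + E / μ * S * r) (Ioc 0 L) := by
    refine monotoneOn_of_deriv_nonneg (convex_Ioc 0 L)
      (h.derivCont.add (continuousOn_const.mul continuousOn_id)) ?_ ?_
    · rw [interior_Ioc]
      exact fun r hr => ((h.diff2 r hr).add
        (differentiableAt_id.const_mul _)).differentiableWithinAt
    · rw [interior_Ioc]
      intro r hr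
      have hd : deriv (fun r => deriv m₁ r + E / μ * S * r) r
          = deriv (deriv m₁) r + E / μ * S * 1 :=
        ((h.diff2 r hr).hasDerivAt.add ((hasDerivAt_id r).const_mul _)).deriv
      have hode : deriv (deriv m₁) r = (v r - E) * m₁ r / μ := by
        rw [eq_div_iff hμ.ne', ← h.ode r hr, mul_comm]
      have hrS : m₁ r ≤ S := hmax (Ioo_subset_Icc_self hr)
      have h0 := mul_nonneg (hv r) (h.nonneg (Ioo_subset_Icc_self hr))
      have h1 := mul_nonneg hE0 (sub_nonneg.2 hrS)
      rw [hd, hode, show (v r - E) * m₁ r / μ + E / μ * S * 1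
        = (v r * m₁ r + E * (S - m₁ r)) / μ by ring]
      positivity
  have hderiv : ∀ r ∈ Ioc 0 L, deriv m₁ r ≤ 1 + E / μ * S * L := by
    intro r hr
    have := hmono hr (right_mem_Ioc.2 hL) hr.2
    simp only [h.bc'] at this
    have h0 : 0 ≤ E / μ * S * r := mul_nonneg (by positivity) hr.1.le
    linarith
  have hanti : MonotoneOn (fun r => (1 + E / μ * S * L) * r - m₁ r) (Icc 0 L) := by
    refine monotoneOn_of_deriv_nonneg (convex_Icc 0 L)
      ((continuousOn_const.mul continuousOn_id).sub h.cont) ?_ ?_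
    · rw [interior_Icc]
      exact fun r hr => ((differentiableAt_id.const_mul _).sub
        (h.diff r (Ioo_subset_Ioc_self hr))).differentiableWithinAt
    · rw [interior_Icc]
      intro r hr
      have hd : deriv (fun r => (1 + E / μ * S * L) * r - m₁ r) r
          = (1 + E / μ * S * L) * 1 - deriv m₁ r :=
        (((hasDerivAt_id r).const_mul _).sub
          (h.diff r (Ioo_subset_Ioc_self hr)).hasDerivAt).deriv
      rw [hd]
      linarith [hderiv r (Ioo_subset_Ioc_self hr)]
  have hlin : ∀ r ∈ Icc 0 L, m₁ r ≤ (1 + E / μ * S * L) * r := by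
    intro r hr
    have := hanti (left_mem_Icc.2 hL.le) hr hr.1
    simp only [h.zero] at this
    linarith
  have hSL : S ≤ 2 * L := by
    have h1 := hlin s hs
    have h2 : (1 + E / μ * S * L) * s ≤ (1 + E / μ * S * L) * L :=
      mul_le_mul_of_nonneg_left hs.2 (by positivity)
    have h3 := mul_le_mul_of_nonneg_right hE' hS0
    have h4 : (1 + E / μ * S * L) * L = L + E / μ * L ^ 2 * S := by ring
    change S ≤ _ at h1
    linarith
  have h1 : E / μ * S * L ≤ 1 := by
    have h2 := mul_le_mul_of_nonneg_left hSL (by positivity : 0 ≤ E / μ * L)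
    have h3 : E / μ * L * (2 * L) = 2 * (E / μ * L ^ 2) := by ring
    have h4 : E / μ * L * S = E / μ * S * L := by ring
    linarith
  exact (hlin r hr).trans (mul_le_mul_of_nonneg_right (by linarith) hr.1)

lemma hasDerivAt_wronskian (h : NeumannScattering v μ L E m₁)
    (hz : ZeroEnergyScattering v R₀ μ m) {r : ℝ} (hr : r ∈ Ioo 0 L) :
    HasDerivAt (fun r => μ * (m r * deriv m₁ r - m₁ r * deriv m r)) (-(E * (m r * m₁ r))) r := by
  have hd := ((((hz.diff r hr.1).hasDerivAt.mul (h.diff2 r hr).hasDerivAt).sub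
    ((h.diff r (Ioo_subset_Ioc_self hr)).hasDerivAt.mul
      (hz.diff2 r hr.1).hasDerivAt)).const_mul μ)
  refine hd.congr_deriv ?_
  linear_combination m r * h.ode r hr - m₁ r * hz.ode r hr.1

lemma continuousOn_wronskian (h : NeumannScattering v μ L E m₁)
    (hz : ZeroEnergyScattering v R₀ μ m) (hμ : 0 < μ) (hB : ∀ r, |v r| ≤ B) :
    ContinuousOn (fun r => μ * (m r * deriv m₁ r - m₁ r * deriv m r)) (Icc 0 L) :=
  continuousOn_const.mul
    ((h.continuousOn_mul_deriv hμ hB (hz.cont.mono fun _ hr => hr.1) hz.zero).sub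
      (hz.continuousOn_mul_deriv hμ hB h.cont h.zero))

lemma wronskian_nonpos (h : NeumannScattering v μ L E m₁)
    (hz : ZeroEnergyScattering v R₀ μ m) (hμ : 0 < μ) (hB : ∀ r, |v r| ≤ B) (hE0 : 0 ≤ E)
    {r : ℝ} (hr : r ∈ Icc 0 L) : m r * deriv m₁ r - m₁ r * deriv m r ≤ 0 := by
  have hanti : AntitoneOn (fun r => μ * (m r * deriv m₁ r - m₁ r * deriv m r)) (Icc 0 L) := by
    refine antitoneOn_of_deriv_nonpos (convex_Icc 0 L) (h.continuousOn_wronskian hz hμ hB) ?_ ?_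
    · rw [interior_Icc]
      exact fun r hr => (h.hasDerivAt_wronskian hz hr).differentiableAt.differentiableWithinAt
    · rw [interior_Icc]
      intro r hr
      rw [(h.hasDerivAt_wronskian hz hr).deriv]
      exact neg_nonpos.2 (mul_nonneg hE0 (mul_nonneg (hz.nonneg hr.1.le)
        (h.nonneg (Ioo_subset_Icc_self hr))))
  have := hanti ⟨le_rfl, hr.1.trans hr.2⟩ hr hr.1
  simp only [hz.zero, h.zero, zero_mul, sub_zero, mul_zero] at this
  exact nonpos_of_mul_nonpos_right this hμ

/-- The Neumann solution dominates the zero-energy solution. -/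
lemma zeroEnergy_le (h : NeumannScattering v μ L E m₁) (hz : ZeroEnergyScattering v R₀ μ m)
    (hμ : 0 < μ) (hv : ∀ r, 0 ≤ v r) (hB : ∀ r, |v r| ≤ B) (hE0 : 0 ≤ E)
    {r : ℝ} (hr : r ∈ Icc 0 L) : m r ≤ m₁ r := by
  rcases hr.1.eq_or_lt with rfl | hr0
  · rw [hz.zero, h.zero]
  have hanti : AntitoneOn (fun r => m₁ r / m r) (Ioc 0 L) := by
    refine antitoneOn_of_deriv_nonpos (convex_Ioc 0 L)
      ((h.cont.mono Ioc_subset_Icc_self).div (hz.cont.mono fun _ hr => hr.1.le)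
        fun r hr => (hz.pos r hr.1).ne') ?_ ?_
    · rw [interior_Ioc]
      exact fun r hr => ((h.diff r (Ioo_subset_Ioc_self hr)).div (hz.diff r hr.1)
        (hz.pos r hr.1).ne').differentiableWithinAt
    · rw [interior_Ioc]
      intro r hr
      have hd : deriv (fun r => m₁ r / m r) r
          = (deriv m₁ r * m r - m₁ r * deriv m r) / m r ^ 2 :=
        ((h.diff r (Ioo_subset_Ioc_self hr)).hasDerivAt.div (hz.diff r hr.1).hasDerivAt
          (hz.pos r hr.1).ne').deriv
      rw [hd]
      refine div_nonpos_of_nonpos_of_nonneg ?_ (sq_nonneg _)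
      linarith [h.wronskian_nonpos hz hμ hB hE0 (Ioo_subset_Icc_self hr)]
  have hL : 0 < L := hr0.trans_le hr.2
  have hle := hanti ⟨hr0, hr.2⟩ (right_mem_Ioc.2 hL) hr.2
  have h1 : 1 ≤ m₁ L / m L := by
    rw [h.bc, one_le_div (hz.pos L hL)]
    exact hz.le_self hμ hv hL.le
  exact (one_le_div (hz.pos r hr0)).1 (h1.trans hle)

/-- The flux identity for the Neumann problem, obtained from Green's identity with the test
function `r - m`. -/
lemma integral_sub_eq (h : NeumannScattering v μ L E m₁) (hz : ZeroEnergyScattering v R₀ μ m)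
    (hμ : 0 < μ) (hvm : Measurable v) (hB : ∀ r, |v r| ≤ B) (hR₀ : 0 < R₀) (hL : R₀ < L) :
    (∫ r in (0 : ℝ)..L, v r * (r * m₁ r)) - E * ∫ r in (0 : ℝ)..L, (r - m r) * m₁ r
      = μ * (R₀ - m R₀) := by
  have hL0 : 0 ≤ L := (hR₀.trans hL).le
  have hm : ContinuousOn m (Icc 0 L) := hz.cont.mono fun r hr => hr.1
  have hint₁ : IntervalIntegrable (fun r => v r * (r * m₁ r)) volume 0 L :=
    intervalIntegrable_mul_of_bounded hL0 hvm hB (continuousOn_id.mul h.cont)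
  have hint₂ : IntervalIntegrable (fun r => E * ((r - m r) * m₁ r)) volume 0 L := by
    refine ContinuousOn.intervalIntegrable ?_
    rw [uIcc_of_le hL0]
    exact continuousOn_const.mul ((continuousOn_id.sub hm).mul h.cont)
  rw [← intervalIntegral.integral_const_mul, ← intervalIntegral.integral_sub hint₁ hint₂,
    intervalIntegral.integral_eq_sub_of_hasDerivAt_of_le
      (f := fun r => μ * (r * deriv m₁ r - m₁ r)
        - μ * (m r * deriv m₁ r - m₁ r * deriv m r)) hL0
      ((continuousOn_const.mul ((h.continuousOn_mul_deriv hμ hB continuousOn_id rfl).sub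
        h.cont)).sub (h.continuousOn_wronskian hz hμ hB))]
  · rw [hz.deriv_eq_one hL, hz.radiation L hL.le, hz.zero, h.zero, h.bc, h.bc']
    ring
  · intro r hr
    have hd := (((((hasDerivAt_id r).mul (h.diff2 r hr).hasDerivAt).sub
      (h.diff r (Ioo_subset_Ioc_self hr)).hasDerivAt).const_mul μ).sub
      (h.hasDerivAt_wronskian hz hr))
    refine hd.congr_deriv ?_
    simp only [id]
    linear_combination r * h.ode r hr
  · exact hint₁.sub hint₂

end NeumannScattering

/-- **Emergence of the scattering length for the Neumann problem.**  There exist `C > 0` and a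
threshold `L₀ ≥ R₀`, depending only on `v` and `R₀`, such that whenever `L ≥ L₀`,
`0 ≤ E ≤ 3μ𝔞₀^μ/(L-R₀)³` and `f_L = m₁/r` is the Neumann scattering function of a Neumann
scattering solution with energy `E`, regarded as the radial function `f_L(|x|)` on the ball
of radius `L` in `ℝ³`, one has
`|∫_{|x|≤L} v(|x|) f_L(|x|) dx - 4πμ𝔞₀^μ| ≤ C 𝔞₀^μ/L` and
`|∫_{|x|≤L} v(|x|) f_L(|x|)² dx - ∫_{ℝ³} v(|x|) f(|x|)² dx| ≤ C μ 𝔞₀^μ/L`. -/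
theorem neumann_scattering_length_integrals
    (R₀ : ℝ) (hR₀ : 0 < R₀)
    (v : ℝ → ℝ) (hv_meas : Measurable v) (hv_nonneg : ∀ r, 0 ≤ v r)
    (hv_bdd : BddAbove (Set.range v))
    (hv_supp : ∀ r, R₀ ≤ r → v r = 0) :
    ∃ C > (0 : ℝ), ∃ L₀ ≥ R₀,
      ∀ μ : ℝ, 0 < μ →
      ∀ m : ℝ → ℝ, ZeroEnergyScattering v R₀ μ m →
      ∀ L E : ℝ, L₀ ≤ L → 0 ≤ E → E ≤ 3 * μ * (R₀ - m R₀) / (L - R₀) ^ 3 →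
      ∀ m₁ : ℝ → ℝ, NeumannScattering v μ L E m₁ →
        |(∫ x in Metric.closedBall (0 : EuclideanSpace ℝ (Fin 3)) L,
            v ‖x‖ * (m₁ ‖x‖ / ‖x‖)) - 4 * Real.pi * μ * (R₀ - m R₀)|
          ≤ C * (R₀ - m R₀) / L ∧
        |(∫ x in Metric.closedBall (0 : EuclideanSpace ℝ (Fin 3)) L,
            v ‖x‖ * (m₁ ‖x‖ / ‖x‖) ^ 2) -
          ∫ x : EuclideanSpace ℝ (Fin 3), v ‖x‖ * (m ‖x‖ / ‖x‖) ^ 2|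
          ≤ C * μ * (R₀ - m R₀) / L := by
  obtain ⟨B, hBv⟩ := hv_bdd
  have hB : ∀ r, |v r| ≤ B := fun r => by
    rw [abs_of_nonneg (hv_nonneg r)]
    exact hBv (mem_range_self r)
  have hB0 : 0 ≤ B := (abs_nonneg _).trans (hB 0)
  have hpi := Real.pi_pos
  refine ⟨320 * Real.pi * B * R₀ ^ 3 + 120 * Real.pi * R₀, by positivity, 10 * R₀,
    by linarith, ?_⟩
  intro μ hμ m hz L E hL hE0 hE m₁ h
  have hL0 : 0 < L := by linarith
  have hRL : R₀ < L := by linarith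
  have ha_le : R₀ - m R₀ ≤ R₀ := by linarith [hz.pos R₀ hR₀]
  have ha0 : 0 ≤ R₀ - m R₀ := by linarith [hz.le_self hμ hv_nonneg hR₀.le]
  have hflux := hz.integral_eq hμ hv_meas hB hR₀ hRL
  have hμa : μ * (R₀ - m R₀) ≤ 8 * B * R₀ ^ 3 := by
    rw [← hz.integral_eq hμ hv_meas hB hR₀ (by linarith : R₀ < 2 * R₀)]
    have hbd : ∀ r ∈ uIoc 0 (2 * R₀), ‖v r * (r * m r)‖ ≤ B * (2 * R₀ * (2 * R₀)) := by
      intro r hr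
      rw [uIoc_of_le (by linarith)] at hr
      rw [norm_mul, norm_mul]
      have h0 := hz.nonneg hr.1.le
      have h1 := hz.le_self hμ hv_nonneg hr.1.le
      have hr0 := hr.1.le
      rw [Real.norm_of_nonneg hr.1.le, Real.norm_of_nonneg h0]
      exact mul_le_mul (hB r) (mul_le_mul hr.2 (h1.trans hr.2) h0 (by linarith))
        (by positivity) hB0
    have := intervalIntegral.norm_integral_le_of_norm_le_const hbd
    rw [sub_zero, abs_of_pos (by linarith : 0 < 2 * R₀)] at this
    have := (le_abs_self _).trans this
    linarith
  set a := R₀ - m R₀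
  have hEL3 : E * L ^ 3 ≤ 5 * μ * a := by
    have hpos : 0 < (L - R₀) ^ 3 := pow_pos (by linarith) 3
    rw [le_div_iff₀ hpos] at hE
    have h9 : (9 / 10 * L) ^ 3 ≤ (L - R₀) ^ 3 :=
      pow_le_pow_left₀ (by linarith) (by linarith) 3
    have h1 := mul_le_mul_of_nonneg_left h9 hE0
    have h2 : 0 ≤ E * L ^ 3 := by positivity
    nlinarith
  have hEL2 : E * L ^ 2 ≤ 5 * μ * a / L := by
    rw [le_div_iff₀ hL0]
    linarith
  have hsmall : E * L ^ 2 ≤ μ / 2 := by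
    refine hEL2.trans ?_
    rw [div_le_iff₀ hL0]
    nlinarith
  have htwo := fun r hr => h.le_two_mul (r := r) hμ hv_nonneg hL0 hE0 hsmall hr
  have hge := fun r hr => h.zeroEnergy_le (r := r) hz hμ hv_nonneg hB hE0 hr
  have hm : ContinuousOn m (Icc 0 L) := hz.cont.mono fun r hr => hr.1
  have hid := h.integral_sub_eq hz hμ hv_meas hB hR₀ hRL
  have hD0 : 0 ≤ ∫ r in (0 : ℝ)..L, (r - m r) * m₁ r :=
    intervalIntegral.integral_nonneg hL0.le fun r hr =>
      mul_nonneg (sub_nonneg.2 (hz.le_self hμ hv_nonneg hr.1)) (h.nonneg hr)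
  have hD1 : ∫ r in (0 : ℝ)..L, (r - m r) * m₁ r ≤ a * (2 * L) * L := by
    have hle : ∫ r in (0 : ℝ)..L, (r - m r) * m₁ r ≤ ∫ r in (0 : ℝ)..L, a * (2 * L) := by
      refine intervalIntegral.integral_mono_on hL0.le ?_ intervalIntegrable_const ?_
      · refine ContinuousOn.intervalIntegrable ?_
        rw [uIcc_of_le hL0.le]
        exact (continuousOn_id.sub hm).mul h.cont
      · intro r hr
        exact mul_le_mul (hz.sub_le hμ hv_nonneg hr.1)
          ((htwo r hr).trans (by linarith [hr.2])) (h.nonneg hr) ha0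
    rw [intervalIntegral.integral_const, smul_eq_mul, sub_zero] at hle
    linarith
  set D := (∫ r in (0 : ℝ)..L, v r * (r * m₁ r)) - μ * a with hD
  have hD_nonneg : 0 ≤ D := by
    have := mul_nonneg hE0 hD0
    linarith
  have hD_le : D ≤ 10 * μ * a * a / L := by
    have h1 := mul_le_mul_of_nonneg_left hD1 hE0
    have h2 := mul_le_mul_of_nonneg_right hEL2 (by linarith : 0 ≤ 2 * a)
    have h3 : 5 * μ * a / L * (2 * a) = 10 * μ * a * a / L := by ring
    linarith
  have hball : ∀ k : ℕ, (∫ x in Metric.closedBall (0 : EuclideanSpace ℝ (Fin 3)) L,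
      v ‖x‖ * (m₁ ‖x‖ / ‖x‖) ^ k)
        = 4 * Real.pi * ∫ r in (0 : ℝ)..L, r ^ 2 * (v r * (m₁ r / r) ^ k) := by
    intro k
    rw [setIntegral_eq_integral_of_forall_compl_eq_zero]
    · exact integral_radial_fin_three (h := fun r => v r * (m₁ r / r) ^ k) hL0.le
        fun r hr => by simp [hv_supp r (hRL.le.trans hr)]
    · intro x hx
      rw [mem_closedBall_zero_iff, not_le] at hx
      rw [hv_supp _ (hRL.trans hx).le, zero_mul]
  have hsq : ∀ u : ℝ → ℝ, u 0 = 0 → ∀ r, r ^ 2 * (v r * (u r / r) ^ 2) = v r * (u r) ^ 2 := by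
    intro u hu r
    rcases eq_or_ne r 0 with rfl | hr
    · simp [hu]
    · field_simp
  constructor
  · have h1 : (∫ x in Metric.closedBall (0 : EuclideanSpace ℝ (Fin 3)) L,
        v ‖x‖ * (m₁ ‖x‖ / ‖x‖)) = 4 * Real.pi * ∫ r in (0 : ℝ)..L, v r * (r * m₁ r) := by
      have := hball 1
      simp only [pow_one] at this
      rw [this]
      congr 2
      ext r
      rcases eq_or_ne r 0 with rfl | hr
      · simp
      · field_simp
    rw [h1, show (4 * Real.pi * ∫ r in (0 : ℝ)..L, v r * (r * m₁ r)) - 4 * Real.pi * μ * a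
      = 4 * Real.pi * D by rw [hD]; ring, abs_of_nonneg (by positivity)]
    rw [le_div_iff₀ hL0] at hD_le ⊢
    have h2 := mul_le_mul_of_nonneg_right hμa ha0
    have h3 : 4 * Real.pi * (D * L) ≤ 4 * Real.pi * (10 * (8 * B * R₀ ^ 3 * a)) :=
      mul_le_mul_of_nonneg_left (by linarith) (by positivity)
    have h4 : 0 ≤ 120 * Real.pi * R₀ * a := by positivity
    linarith
  · have hint : ∀ u : ℝ → ℝ, ContinuousOn u (Icc 0 L) →
        IntervalIntegrable (fun r => v r * u r) volume 0 L := fun u hu =>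
      intervalIntegrable_mul_of_bounded hL0.le hv_meas hB hu
    rw [hball 2, integral_radial_fin_three (h := fun r => v r * (m r / r) ^ 2) hL0.le
      (fun r hr => by simp [hv_supp r (hRL.le.trans hr)]), ← mul_sub]
    simp only [hsq m₁ h.zero, hsq m hz.zero]
    have hsub : (∫ r in (0 : ℝ)..L, v r * m₁ r ^ 2) - (∫ r in (0 : ℝ)..L, v r * m r ^ 2)
        = ∫ r in (0 : ℝ)..L, (v r * m₁ r ^ 2 - v r * m r ^ 2) :=
      (intervalIntegral.integral_sub (hint _ (h.cont.pow 2)) (hint _ (hm.pow 2))).symm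
    have hnonneg : 0 ≤ ∫ r in (0 : ℝ)..L, (v r * m₁ r ^ 2 - v r * m r ^ 2) := by
      refine intervalIntegral.integral_nonneg hL0.le fun r hr => ?_
      rw [← mul_sub]
      exact mul_nonneg (hv_nonneg r)
        (sub_nonneg.2 (pow_le_pow_left₀ (hz.nonneg hr.1) (hge r hr) 2))
    have hle : ∫ r in (0 : ℝ)..L, (v r * m₁ r ^ 2 - v r * m r ^ 2) ≤ 3 * D := by
      have hi₁ := hint (fun r => r * m₁ r) (continuousOn_id.mul h.cont)
      have hi₀ := hint (fun r => r * m r) (continuousOn_id.mul hm)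
      rw [hD, ← hflux, ← intervalIntegral.integral_sub hi₁ hi₀,
        ← intervalIntegral.integral_const_mul]
      refine intervalIntegral.integral_mono_on hL0.le
        ((hint _ (h.cont.pow 2)).sub (hint _ (hm.pow 2))) ((hi₁.sub hi₀).const_mul 3) ?_
      intro r hr
      have h1 : (m₁ r - m r) * (m₁ r + m r) ≤ (m₁ r - m r) * (3 * r) :=
        mul_le_mul_of_nonneg_left
          (by linarith [htwo r hr, hz.le_self hμ hv_nonneg hr.1]) (sub_nonneg.2 (hge r hr))
      have h2 := mul_le_mul_of_nonneg_left h1 (hv_nonneg r)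
      linarith
    rw [hsub, abs_of_nonneg (by positivity)]
    have h1 : 4 * Real.pi * (∫ r in (0 : ℝ)..L, (v r * m₁ r ^ 2 - v r * m r ^ 2))
        ≤ 4 * Real.pi * (3 * D) := mul_le_mul_of_nonneg_left hle (by positivity)
    refine h1.trans ?_
    rw [le_div_iff₀ hL0] at hD_le ⊢
    have h2 : μ * a * a ≤ μ * a * R₀ := mul_le_mul_of_nonneg_left ha_le (by positivity)
    have h3 : 4 * Real.pi * (3 * (D * L)) ≤ 4 * Real.pi * (3 * (10 * (μ * a * R₀))) :=
      mul_le_mul_of_nonneg_left (by linarith) (by positivity)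
    have h4 : 0 ≤ 320 * Real.pi * B * R₀ ^ 3 * μ * a := by positivity
    linarith
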